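/- arXiv:2108.00458 — 2 statements merged into one kernel-verified Lean document; each statement's English description precedes it below -/
import Mathlib

section
/- Let b ∈ {0,1} and let a ≤ 2 be an integer. Let T(a,b) be the complex with terms indexed by k = a, a+1, …, 2, where for a < k ≤ 2 the term at position k is Δ⁻(Λ₊ᵏ∧Λ₋^{b−1} ⊗ ℂ[u₁,u₂]), the term at position a is the cokernel of Δ⁺ : Δ⁻(Λ₊^{a−1}∧Λ₋^{b−1} ⊗ ℂ[u₁,u₂]) → Δ⁻(Λ₊ᵃ∧Λ₋^{b−1} ⊗ ℂ[u₁,u₂]), and the differential from position k to position k+1 is (induced by) Δ⁺. Then for every a ≤ k ≤ 2 the homology of T(a,b) at position k is a ℂ-vector space of dimension binom(2, k+b−3), interpreted as 0 when k+b−3 < 0. -/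
/- Setup: `Ex = ⋀(ℂ⁴)` is the exterior algebra on generators `f 0, f 1, f 2, f 3`
(`f 0, f 1` the "plus" generators, `f 2, f 3` the "minus" generators).
`lamPM k b` is the subspace `Λ₊ᵏ∧Λ₋ᵇ` (zero for negative indices).
On `Ex ⊗[ℂ] ℂ[u₁,u₂]` the operators are
`Δ⁺(ω ⊗ p) = (f₁∧ω) ⊗ u₁p + (f₂∧ω) ⊗ u₂p` and
`Δ⁻(ω ⊗ p) = (f₃∧ω) ⊗ u₁p + (f₄∧ω) ⊗ u₂p`. -/

set_option synthInstance.maxHeartbeats 1000000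
set_option maxHeartbeats 1000000

noncomputable section

open scoped TensorProduct

abbrev Ex : Type := ExteriorAlgebra ℂ (Fin 4 → ℂ)

def f (i : Fin 4) : Ex := ExteriorAlgebra.ι ℂ (Pi.single i 1)

/-- `Λ₊ᵏ∧Λ₋ᵇ` for integer indices (zero when `k < 0` or `b < 0`). -/
def lamPM (k b : ℤ) : Submodule ℂ Ex :=
  Submodule.span ℂ {x | ∃ lp lm : List (Fin 2), (lp.length : ℤ) = k ∧ (lm.length : ℤ) = b ∧
    x = (lp.map (fun i : Fin 2 => f ⟨i.1, by have := i.2; omega⟩)).prod *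
        (lm.map (fun i : Fin 2 => f ⟨i.1 + 2, by have := i.2; omega⟩)).prod}

abbrev P2 : Type := MvPolynomial (Fin 2) ℂ

abbrev MEx : Type := Ex ⊗[ℂ] P2

instance : AddCommGroup MEx := inferInstance
instance : Module ℂ MEx := inferInstance

/-- `Δ⁺(ω ⊗ p) = (f₁∧ω) ⊗ u₁p + (f₂∧ω) ⊗ u₂p` -/
def Δp : MEx →ₗ[ℂ] MEx :=
  TensorProduct.map (LinearMap.mulLeft ℂ (f 0)) (LinearMap.mulLeft ℂ (MvPolynomial.X 0 : P2)) +
  TensorProduct.map (LinearMap.mulLeft ℂ (f 1)) (LinearMap.mulLeft ℂ (MvPolynomial.X 1 : P2))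

/-- `Δ⁻(ω ⊗ p) = (f₃∧ω) ⊗ u₁p + (f₄∧ω) ⊗ u₂p` -/
def Δm : MEx →ₗ[ℂ] MEx :=
  TensorProduct.map (LinearMap.mulLeft ℂ (f 2)) (LinearMap.mulLeft ℂ (MvPolynomial.X 0 : P2)) +
  TensorProduct.map (LinearMap.mulLeft ℂ (f 3)) (LinearMap.mulLeft ℂ (MvPolynomial.X 1 : P2))

/-- `Λ₊ᵏ∧Λ₋ᵇ ⊗ ℂ[u₁,u₂]` inside `Ex ⊗ ℂ[u₁,u₂]`. -/
def sect (k b : ℤ) : Submodule ℂ MEx :=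
  Submodule.span ℂ {z | ∃ ω ∈ lamPM k b, ∃ p : P2, z = ω ⊗ₜ p}

/-- The numerator of the homology of `T(a,b)` at position `k`: the kernel of the
outgoing differential `Δ⁺` on `Δ⁻(Λ₊ᵏ∧Λ₋^{b−1} ⊗ ℂ[u₁,u₂])` (at the last position
`k = 2` the outgoing differential is zero on this term, so this is the whole term;
at the position `k = a` this computes the kernel of the differential induced on the
cokernel term of `T(a,b)` after dividing by the image below). -/
def Tnum (k b : ℤ) : Submodule ℂ MEx :=
  Submodule.map Δm (sect k (b - 1)) ⊓ LinearMap.ker Δp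

/-- The denominator: the image of the incoming differential `Δ⁺` (this is also the
subspace one divides by to form the cokernel term at position `k = a`). -/
def Tden (k b : ℤ) : Submodule ℂ MEx :=
  Submodule.map Δp (Submodule.map Δm (sect (k - 1) (b - 1)))

/-- `binom(2, n)` for an integer `n`, interpreted as `0` when `n < 0`. -/
def zbinom (n : ℤ) : ℕ := if 0 ≤ n then Nat.choose 2 n.toNat else 0

theorem f_sq (i : Fin 4) : f i * f i = 0 := ExteriorAlgebra.ι_sq_zero _

theorem f_swap (i j : Fin 4) : f i * f j = - (f j * f i) :=
  eq_neg_of_add_eq_zero_left (ExteriorAlgebra.ι_add_mul_swap _ _)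

theorem f_swap_mul (i j : Fin 4) (x : Ex) : f i * (f j * x) = - (f j * (f i * x)) := by
  rw [← mul_assoc, f_swap, neg_mul, mul_assoc]

def Dc (i : Fin 4) : Ex →ₗ[ℂ] Ex :=
  CliffordAlgebra.contractLeft (Q := (0 : QuadraticForm ℂ (Fin 4 → ℂ))) (LinearMap.proj i)

theorem Dc_mul (i j : Fin 4) (x : Ex) :
    Dc i (f j * x) = (if i = j then x else 0) - f j * Dc i x := by
  have h := CliffordAlgebra.contractLeft_ι_mul (Q := (0 : QuadraticForm ℂ (Fin 4 → ℂ)))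
    (d := LinearMap.proj i) (Pi.single j 1) x
  refine h.trans ?_
  by_cases hij : i = j
  · subst hij; simp; rfl
  · simp [Pi.single_apply, hij]; rfl

theorem Dc_one (i : Fin 4) : Dc i 1 = 0 := CliffordAlgebra.contractLeft_one _ _

theorem Dc_f (i j : Fin 4) : Dc i (f j) = if i = j then 1 else 0 := by
  have := Dc_mul i j 1
  simpa [Dc_one] using this

def ev : Ex →ₗ[ℂ] ℂ := (ExteriorAlgebra.algebraMapInv (R := ℂ) (M := Fin 4 → ℂ)).toLinearMap

theorem ev_one : ev 1 = 1 := by simp [ev]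

def cf (L : Ex →ₗ[ℂ] ℂ) : MEx →ₗ[ℂ] P2 :=
  (TensorProduct.lid ℂ P2).toLinearMap ∘ₗ (LinearMap.rTensor P2 L)

theorem cf_tmul (L : Ex →ₗ[ℂ] ℂ) (x : Ex) (p : P2) : cf L (x ⊗ₜ p) = L x • p := by
  simp [cf]

def L2 : Ex →ₗ[ℂ] ℂ := ev ∘ₗ Dc 2 ∘ₗ Dc 0
def L3 : Ex →ₗ[ℂ] ℂ := ev ∘ₗ Dc 2 ∘ₗ Dc 1 ∘ₗ Dc 0

theorem Δp_tmul (x : Ex) (p : P2) : Δp (x ⊗ₜ p) =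
    (f 0 * x) ⊗ₜ (MvPolynomial.X 0 * p) + (f 1 * x) ⊗ₜ (MvPolynomial.X 1 * p) := by
  simp [Δp]

theorem Δm_tmul (x : Ex) (p : P2) : Δm (x ⊗ₜ p) =
    (f 2 * x) ⊗ₜ (MvPolynomial.X 0 * p) + (f 3 * x) ⊗ₜ (MvPolynomial.X 1 * p) := by
  simp [Δm]

theorem Δ_anti (z : MEx) : Δp (Δm z) = - Δm (Δp z) := by
  induction z using TensorProduct.induction_on with
  | zero => simp
  | add x y hx hy => simp only [map_add, hx, hy]; abel
  | tmul x p =>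
    simp only [Δp_tmul, Δm_tmul, map_add]
    rw [f_swap_mul 0 2, f_swap_mul 0 3, f_swap_mul 1 2, f_swap_mul 1 3,
      mul_left_comm (MvPolynomial.X 0 : P2) (MvPolynomial.X 1 : P2) p]
    simp only [TensorProduct.neg_tmul]
    abel

theorem tm_mem {k b : ℤ} {x : Ex} (hx : x ∈ lamPM k b) (p : P2) : x ⊗ₜ p ∈ sect k b :=
  Submodule.subset_span ⟨x, hx, p, rfl⟩

theorem lam_zero : (1 : Ex) ∈ lamPM 0 0 :=
  Submodule.subset_span ⟨[], [], by simp, by simp, by simp⟩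
theorem lam_one0 : f 0 ∈ lamPM 1 0 :=
  Submodule.subset_span ⟨[0], [], by simp, by simp, by simp⟩
theorem lam_one1 : f 1 ∈ lamPM 1 0 :=
  Submodule.subset_span ⟨[1], [], by simp, by simp, by simp⟩
theorem lam_two : f 0 * f 1 ∈ lamPM 2 0 :=
  Submodule.subset_span ⟨[0, 1], [], by simp, by simp, by simp⟩

theorem sect_neg_right (k b : ℤ) (hb : b < 0) : sect k b = ⊥ := by
  have h : lamPM k b = ⊥ := by
    rw [lamPM, Submodule.span_eq_bot]
    rintro x ⟨lp, lm, h1, h2, h3⟩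
    omega
  rw [sect, Submodule.span_eq_bot]
  rintro z ⟨w, hw, p, rfl⟩
  rw [h, Submodule.mem_bot] at hw
  rw [hw, TensorProduct.zero_tmul]

theorem sect_neg_left (k b : ℤ) (hk : k < 0) : sect k b = ⊥ := by
  have h : lamPM k b = ⊥ := by
    rw [lamPM, Submodule.span_eq_bot]
    rintro x ⟨lp, lm, h1, h2, h3⟩
    omega
  rw [sect, Submodule.span_eq_bot]
  rintro z ⟨w, hw, p, rfl⟩
  rw [h, Submodule.mem_bot] at hw
  rw [hw, TensorProduct.zero_tmul]

theorem lam0 {x : Ex} (hx : x ∈ lamPM 0 0) : ∃ c : ℂ, x = c • (1 : Ex) := by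
  have h : lamPM 0 0 ≤ Submodule.span ℂ {(1 : Ex)} := by
    refine Submodule.span_le.2 ?_
    rintro x ⟨lp, lm, h1, h2, rfl⟩
    have h1 : lp = [] := List.length_eq_zero_iff.1 (by omega)
    have h2 : lm = [] := List.length_eq_zero_iff.1 (by omega)
    subst h1 h2
    simpa using Submodule.mem_span_singleton_self (R := ℂ) (1 : Ex)
  obtain ⟨c, hc⟩ := Submodule.mem_span_singleton.1 (h hx)
  exact ⟨c, hc.symm⟩

theorem lam1 {x : Ex} (hx : x ∈ lamPM 1 0) : ∃ c d : ℂ, x = c • f 0 + d • f 1 := by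
  have h : lamPM 1 0 ≤ Submodule.span ℂ {f 0, f 1} := by
    refine Submodule.span_le.2 ?_
    rintro x ⟨lp, lm, h1, h2, rfl⟩
    obtain ⟨i, rfl⟩ := List.length_eq_one_iff.1 (show lp.length = 1 by omega)
    have h2 : lm = [] := List.length_eq_zero_iff.1 (by omega)
    subst h2
    fin_cases i
    · simpa using Submodule.subset_span (by simp)
    · simpa using Submodule.subset_span (by simp)
  obtain ⟨c, d, hc⟩ := Submodule.mem_span_pair.1 (h hx)
  exact ⟨c, d, hc.symm⟩

theorem lam2 {x : Ex} (hx : x ∈ lamPM 2 0) : ∃ c : ℂ, x = c • (f 0 * f 1) := by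
  have h : lamPM 2 0 ≤ Submodule.span ℂ {f 0 * f 1} := by
    refine Submodule.span_le.2 ?_
    rintro x ⟨lp, lm, h1, h2, rfl⟩
    obtain ⟨i, j, rfl⟩ := List.length_eq_two.1 (show lp.length = 2 by omega)
    have h2 : lm = [] := List.length_eq_zero_iff.1 (by omega)
    subst h2
    have hs := Submodule.mem_span_singleton_self (R := ℂ) (f 0 * f 1)
    fin_cases i <;> fin_cases j
    · simp [f_sq]
    · simpa using hs
    · have := f_swap 1 0
      simp [this, hs]
    · simp [f_sq]
  obtain ⟨c, hc⟩ := Submodule.mem_span_singleton.1 (h hx)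
  exact ⟨c, hc.symm⟩

theorem sect0 {z : MEx} (hz : z ∈ sect 0 0) : ∃ p : P2, z = (1 : Ex) ⊗ₜ p := by
  induction hz using Submodule.span_induction with
  | mem x h =>
    obtain ⟨w, hw, p, rfl⟩ := h
    obtain ⟨c, rfl⟩ := lam0 hw
    exact ⟨c • p, by rw [TensorProduct.smul_tmul]⟩
  | zero => exact ⟨0, by simp⟩
  | add x y _ _ hx hy =>
    obtain ⟨p, rfl⟩ := hx
    obtain ⟨q, rfl⟩ := hy
    exact ⟨p + q, by rw [TensorProduct.tmul_add]⟩
  | smul a x _ hx =>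
    obtain ⟨p, rfl⟩ := hx
    exact ⟨a • p, by rw [TensorProduct.tmul_smul]⟩

theorem sect1 {z : MEx} (hz : z ∈ sect 1 0) : ∃ p q : P2, z = f 0 ⊗ₜ p + f 1 ⊗ₜ q := by
  induction hz using Submodule.span_induction with
  | mem x h =>
    obtain ⟨w, hw, p, rfl⟩ := h
    obtain ⟨c, d, rfl⟩ := lam1 hw
    exact ⟨c • p, d • p, by rw [TensorProduct.add_tmul, TensorProduct.smul_tmul,
      TensorProduct.smul_tmul]⟩
  | zero => exact ⟨0, 0, by simp⟩
  | add x y _ _ hx hy =>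
    obtain ⟨p, q, rfl⟩ := hx
    obtain ⟨p', q', rfl⟩ := hy
    exact ⟨p + p', q + q', by rw [TensorProduct.tmul_add, TensorProduct.tmul_add]; abel⟩
  | smul a x _ hx =>
    obtain ⟨p, q, rfl⟩ := hx
    exact ⟨a • p, a • q, by rw [TensorProduct.tmul_smul, TensorProduct.tmul_smul, smul_add]⟩

theorem sect2 {z : MEx} (hz : z ∈ sect 2 0) : ∃ p : P2, z = (f 0 * f 1) ⊗ₜ p := by
  induction hz using Submodule.span_induction with
  | mem x h =>
    obtain ⟨w, hw, p, rfl⟩ := h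
    obtain ⟨c, rfl⟩ := lam2 hw
    exact ⟨c • p, by rw [TensorProduct.smul_tmul]⟩
  | zero => exact ⟨0, by simp⟩
  | add x y _ _ hx hy =>
    obtain ⟨p, rfl⟩ := hx
    obtain ⟨q, rfl⟩ := hy
    exact ⟨p + q, by rw [TensorProduct.tmul_add]⟩
  | smul a x _ hx =>
    obtain ⟨p, rfl⟩ := hx
    exact ⟨a • p, by rw [TensorProduct.tmul_smul]⟩

theorem calc0 (p : P2) : cf L2 (Δp (Δm ((1 : Ex) ⊗ₜ p))) =
    MvPolynomial.X 0 * (MvPolynomial.X 0 * p) := by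
  simp [Δp_tmul, Δm_tmul, cf_tmul, L2, Dc_mul, Dc_f, Dc_one, ev_one]

theorem calc1 (p q : P2) : cf L3 (Δp (Δm (f 0 ⊗ₜ p + f 1 ⊗ₜ q))) =
    MvPolynomial.X 0 * (MvPolynomial.X 1 * p - MvPolynomial.X 0 * q) := by
  simp [Δp_tmul, Δm_tmul, cf_tmul, L3, Dc_mul, Dc_f, Dc_one, ev_one]
  ring

theorem calc2 (p : P2) : cf L3 (Δm ((f 0 * f 1) ⊗ₜ p)) = MvPolynomial.X 0 * p := by
  simp [Δm_tmul, cf_tmul, L3, Dc_mul, Dc_f, Dc_one, ev_one]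

theorem Δp_two (p : P2) : Δp ((f 0 * f 1) ⊗ₜ p) = 0 := by
  rw [Δp_tmul, ← mul_assoc, f_sq, f_swap_mul, f_sq]
  simp

theorem Δp_one (p q : P2) : Δp (f 0 ⊗ₜ p + f 1 ⊗ₜ q) =
    (f 0 * f 1) ⊗ₜ (MvPolynomial.X 0 * q - MvPolynomial.X 1 * p) := by
  rw [map_add, Δp_tmul, Δp_tmul, f_sq, f_sq, f_swap 1 0, TensorProduct.tmul_sub,
    TensorProduct.neg_tmul, TensorProduct.zero_tmul, TensorProduct.zero_tmul]
  abel

theorem koszul (p q : P2) (h : (MvPolynomial.X 1 : P2) * p = MvPolynomial.X 0 * q) :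
    ∃ r, p = MvPolynomial.X 0 * r ∧ q = MvPolynomial.X 1 * r := by
  have h1 : (MvPolynomial.X 0 : P2) ∣ MvPolynomial.X 1 * p := ⟨q, h⟩
  rw [MvPolynomial.X_dvd_mul_iff] at h1
  rcases h1 with h1 | ⟨r, rfl⟩
  · simp at h1
  · refine ⟨r, rfl, ?_⟩
    have hx : (MvPolynomial.X 0 : P2) ≠ 0 := MvPolynomial.X_ne_zero _
    apply mul_left_cancel₀ hx
    rw [← h]; ring

theorem decomp (p : P2) : ∃ q r : P2,
    p = MvPolynomial.C (MvPolynomial.constantCoeff p) + MvPolynomial.X 0 * q +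
      MvPolynomial.X 1 * r := by
  induction p using MvPolynomial.induction_on with
  | C a => exact ⟨0, 0, by simp⟩
  | add p q hp hq =>
    obtain ⟨a, b, h⟩ := hp
    obtain ⟨a', b', h'⟩ := hq
    refine ⟨a + a', b + b', ?_⟩
    rw [map_add, map_add]
    linear_combination h + h'
  | mul_X p i _ =>
    fin_cases i
    · exact ⟨p, 0, by simp; ring⟩
    · exact ⟨0, p, by simp; ring⟩

theorem triv_quot (k b : ℤ) (n : ℕ) (hn : n = 0) (h : Tnum k b ≤ Tden k b) :
    Nonempty ((↥(Tnum k b) ⧸ (Submodule.comap (Tnum k b).subtype (Tden k b))) ≃ₗ[ℂ]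
      (Fin n → ℂ)) := by
  subst hn
  have : Submodule.comap (Tnum k b).subtype (Tden k b) = ⊤ :=
    Submodule.comap_subtype_eq_top.2 h
  rw [this]
  exact ⟨LinearEquiv.ofSubsingleton _ _⟩

theorem Tnum_bot (k b : ℤ) (h : sect k (b - 1) = ⊥) : Tnum k b ≤ Tden k b := by
  rw [Tnum, h, Submodule.map_bot, bot_inf_eq]
  exact bot_le

theorem T0 : Tnum 0 1 ≤ Tden 0 1 := by
  rintro z ⟨⟨w, hw, rfl⟩, hz⟩
  obtain ⟨p, rfl⟩ := sect0 hw
  have h := calc0 p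
  rw [LinearMap.mem_ker.1 hz, map_zero] at h
  have hx : (MvPolynomial.X 0 : P2) ≠ 0 := MvPolynomial.X_ne_zero _
  have hp : p = 0 := by simpa [hx] using h.symm
  subst hp
  simp

theorem T1 : Tnum 1 1 ≤ Tden 1 1 := by
  rintro z ⟨⟨w, hw, rfl⟩, hz⟩
  obtain ⟨p, q, rfl⟩ := sect1 hw
  have h := calc1 p q
  rw [LinearMap.mem_ker.1 hz, map_zero] at h
  have hx : (MvPolynomial.X 0 : P2) ≠ 0 := MvPolynomial.X_ne_zero _
  have hp : (MvPolynomial.X 1 : P2) * p - MvPolynomial.X 0 * q = 0 := by simpa [hx] using h.symm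
  obtain ⟨r, rfl, rfl⟩ := koszul p q (sub_eq_zero.1 hp)
  refine ⟨Δm ((1 : Ex) ⊗ₜ (-r)), ⟨_, tm_mem lam_zero _, rfl⟩, ?_⟩
  rw [Δ_anti, Δp_tmul, mul_one, mul_one]
  simp only [mul_neg, TensorProduct.tmul_neg, map_add, map_neg]
  abel

def phi : MEx →ₗ[ℂ] ℂ := MvPolynomial.lcoeff ℂ (Finsupp.single 0 1) ∘ₗ cf L3

theorem phi_two (p : P2) : phi (Δm ((f 0 * f 1) ⊗ₜ p)) = MvPolynomial.constantCoeff p := by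
  have : phi (Δm ((f 0 * f 1) ⊗ₜ p)) =
    MvPolynomial.coeff (Finsupp.single 0 1) (cf L3 (Δm ((f 0 * f 1) ⊗ₜ p))) := rfl
  rw [this, calc2, MvPolynomial.coeff_X_mul']
  simp [MvPolynomial.constantCoeff_eq]

theorem T2_mem (p : P2) : Δm ((f 0 * f 1) ⊗ₜ p) ∈ Tnum 2 1 := by
  refine ⟨⟨_, tm_mem lam_two _, rfl⟩, ?_⟩
  rw [SetLike.mem_coe, LinearMap.mem_ker, Δ_anti, Δp_two, map_zero, neg_zero]

theorem T2_ker : LinearMap.ker (phi ∘ₗ (Tnum 2 1).subtype) =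
    Submodule.comap (Tnum 2 1).subtype (Tden 2 1) := by
  ext ⟨z, hz⟩
  rw [LinearMap.mem_ker, Submodule.mem_comap, LinearMap.comp_apply]
  simp only [Submodule.subtype_apply]
  constructor
  · intro h
    obtain ⟨⟨w, hw, rfl⟩, -⟩ := hz
    obtain ⟨p, rfl⟩ := sect2 hw
    rw [phi_two] at h
    obtain ⟨q, r, hp⟩ := decomp p
    rw [h, map_zero, zero_add] at hp
    refine ⟨Δm (f 0 ⊗ₜ r + f 1 ⊗ₜ (-q)), ⟨_, Submodule.add_mem _ (tm_mem lam_one0 _)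
      (tm_mem lam_one1 _), rfl⟩, ?_⟩
    rw [Δ_anti, Δp_one, hp, ← map_neg, ← TensorProduct.tmul_neg]
    congr 2
    ring
  · rintro ⟨_, ⟨w, hw, rfl⟩, rfl⟩
    obtain ⟨p, q, rfl⟩ := sect1 hw
    rw [Δ_anti, Δp_one, map_neg, phi_two]
    simp

theorem T2 : Nonempty ((↥(Tnum 2 1) ⧸ (Submodule.comap (Tnum 2 1).subtype (Tden 2 1))) ≃ₗ[ℂ]
      (Fin 1 → ℂ)) := by
  rw [← T2_ker]
  refine ⟨(LinearMap.quotKerEquivOfSurjective _ ?_).trans (LinearEquiv.funUnique (Fin 1) ℂ ℂ).symm⟩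
  intro c
  exact ⟨⟨_, T2_mem (MvPolynomial.C c)⟩, by simp [phi_two]⟩

/-- for `b ∈ {0,1}`, `a ≤ 2` and `a ≤ k ≤ 2`, the homology of the
complex `T(a,b)` at position `k` is a `ℂ`-vector space of dimension
`binom(2, k+b−3)` (interpreted as `0` when `k+b−3 < 0`). -/
theorem homology_T (a b k : ℤ) (hb : b = 0 ∨ b = 1) (ha : a ≤ 2)
    (hk1 : a ≤ k) (hk2 : k ≤ 2) :
    Nonempty ((↥(Tnum k b) ⧸ (Submodule.comap (Tnum k b).subtype (Tden k b))) ≃ₗ[ℂ]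
      (Fin (zbinom (k + b - 3)) → ℂ)) := by
  rcases hb with rfl | rfl
  · refine triv_quot k 0 _ ?_ (Tnum_bot _ _ (sect_neg_right _ _ (by norm_num)))
    rw [zbinom, if_neg (by omega)]
  · by_cases hk : k < 0
    · refine triv_quot k 1 _ ?_ (Tnum_bot _ _ (sect_neg_left _ _ hk))
      rw [zbinom, if_neg (by omega)]
    · obtain rfl | rfl | rfl : k = 0 ∨ k = 1 ∨ k = 2 := by omega
      · exact triv_quot _ _ _ (by simp [zbinom]) T0
      · exact triv_quot _ _ _ (by simp [zbinom]) T1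
      · exact T2

end
end

section
/- For all integers m ≥ 1 and n ≥ 1, ker(∇ : M_A^{m,n} → M_A^{m−1,n−1}) = ∇(M_A^{m+1,n+1}); that is, the complexes of finite Verma modules of quadrant A over 𝒜(K′₄) are exact at every interior point of the quadrant (including the point M(1,1,−1,0)). -/
/- Setup: `Cl` is the Clifford algebra over `ℂ[Θ]` realizing `U(𝔤₍<₀₎)` for
`𝒜(K′₄)`, with `w11, w22, w12, w21` as in the paper.  On `Cl ⊗[ℂ] ℂ[x₁,x₂,y₁,y₂]`
(variables `X 0, X 1 = x₁, x₂` and `X 2, X 3 = y₁, y₂`) we define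
`∇(u ⊗ p) = u·w₁₁ ⊗ ∂ₓ₁∂ᵧ₁p + u·w₂₁ ⊗ ∂ₓ₂∂ᵧ₁p + u·w₁₂ ⊗ ∂ₓ₁∂ᵧ₂p + u·w₂₂ ⊗ ∂ₓ₂∂ᵧ₂p`,
and `MA m n = Cl ⊗ (bihomogeneous polynomials of degree m in x and n in y)` is the
finite Verma module `M(m,n,−(m+n)/2,(m−n)/2)` of quadrant A. -/

set_option synthInstance.maxHeartbeats 1000000
set_option maxHeartbeats 1000000

noncomputable section

open scoped TensorProduct

def Qf : QuadraticForm (Polynomial ℂ) (Fin 4 → Polynomial ℂ) :=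
  QuadraticMap.weightedSumSquares (Polynomial ℂ) (fun _ : Fin 4 => (Polynomial.X : Polynomial ℂ))

abbrev Cl : Type := CliffordAlgebra Qf

def η (i : Fin 4) : Cl := CliffordAlgebra.ι Qf (Pi.single i 1)

def ii : Cl := algebraMap ℂ Cl Complex.I

def w11 : Cl := η 1 + ii * η 0
def w22 : Cl := η 1 - ii * η 0
def w12 : Cl := -(η 3) + ii * η 2
def w21 : Cl := η 3 + ii * η 2

abbrev P4 : Type := MvPolynomial (Fin 4) ℂ

abbrev MCl : Type := Cl ⊗[ℂ] P4

instance : AddCommGroup MCl := inferInstance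
instance : Module ℂ MCl := inferInstance

def pd (i : Fin 4) : P4 →ₗ[ℂ] P4 := (MvPolynomial.pderiv i).toLinearMap

/-- `∇(u ⊗ p) = u·w₁₁ ⊗ ∂ₓ₁∂ᵧ₁p + u·w₂₁ ⊗ ∂ₓ₂∂ᵧ₁p + u·w₁₂ ⊗ ∂ₓ₁∂ᵧ₂p + u·w₂₂ ⊗ ∂ₓ₂∂ᵧ₂p` -/
def nabla : MCl →ₗ[ℂ] MCl :=
  TensorProduct.map (LinearMap.mulRight ℂ w11) (pd 0 ∘ₗ pd 2) +
  TensorProduct.map (LinearMap.mulRight ℂ w21) (pd 1 ∘ₗ pd 2) +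
  TensorProduct.map (LinearMap.mulRight ℂ w12) (pd 0 ∘ₗ pd 3) +
  TensorProduct.map (LinearMap.mulRight ℂ w22) (pd 1 ∘ₗ pd 3)

/-- weight of the `x`-variables -/
def wx : Fin 4 → ℕ := ![1, 1, 0, 0]
/-- weight of the `y`-variables -/
def wy : Fin 4 → ℕ := ![0, 0, 1, 1]

/-- The Verma module `M_A^{m,n}`: the span of the `u ⊗ p` with `p` bihomogeneous of
degree `m` in `x₁,x₂` and degree `n` in `y₁,y₂`. -/
def MA (m n : ℕ) : Submodule ℂ MCl :=
  Submodule.span ℂ {z | ∃ (u : Cl) (p : P4),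
    MvPolynomial.IsWeightedHomogeneous wx p m ∧ MvPolynomial.IsWeightedHomogeneous wy p n ∧
    z = u ⊗ₜ p}

namespace QA

abbrev A : Type := Polynomial ℂ
abbrev B : Type := Fin 4 → A
abbrev Md : Type := Fin 4 → B

def T : A := 4 * Polynomial.X

def b1 : B →ₗ[A] B where
  toFun u := ![0, u 0, 0, -u 2]
  map_add' u v := by ext i; fin_cases i <;> simp; ring
  map_smul' c u := by ext i; fin_cases i <;> simp

def b2 : B →ₗ[A] B where
  toFun u := ![0, 0, u 0, u 1]
  map_add' u v := by ext i; fin_cases i <;> simp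
  map_smul' c u := by ext i; fin_cases i <;> simp

def rA1 : Md →ₗ[A] Md where
  toFun s := ![0, s 0, 0, -s 2]
  map_add' u v := by ext i; fin_cases i <;> simp; ring
  map_smul' c u := by ext i; fin_cases i <;> simp

def rA2 : Md →ₗ[A] Md where
  toFun s := ![0, 0, s 0, s 1]
  map_add' u v := by ext i; fin_cases i <;> simp
  map_smul' c u := by ext i; fin_cases i <;> simp

def rB1 : Md →ₗ[A] Md where
  toFun s := ![b1 (s 0) - T • s 2, -b1 (s 1) - T • s 3, -b1 (s 2), b1 (s 3)]
  map_add' u v := by ext i j : 2; fin_cases i <;> simp <;> ring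
  map_smul' c u := by ext i j : 2; fin_cases i <;> simp <;> ring

def rB2 : Md →ₗ[A] Md where
  toFun s := ![b2 (s 0) + T • s 1, -b2 (s 1), -b2 (s 2) - T • s 3, b2 (s 3)]
  map_add' u v := by ext i j : 2; fin_cases i <;> simp <;> ring
  map_smul' c u := by ext i j : 2; fin_cases i <;> simp <;> ring

def J : A := Polynomial.C Complex.I
def hf : A := Polynomial.C (1/2)

lemma JJ : J * J = -1 := by
  rw [J, ← Polynomial.C_mul, Complex.I_mul_I, Polynomial.C_neg, Polynomial.C_1]

lemma hf2 : hf * 2 = 1 := by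
  have : (2 : A) = Polynomial.C 2 := (map_ofNat Polynomial.C 2).symm
  rw [this, hf, ← Polynomial.C_mul]; norm_num

def fr : (Fin 4 → A) →ₗ[A] Module.End A Md where
  toFun v := (hf * (v 1 - J * v 0)) • rA1 + (hf * (v 1 + J * v 0)) • rB2
    + (hf * (- v 3 - J * v 2)) • rB1 + (hf * (v 3 - J * v 2)) • rA2
  map_add' u v := by
    simp only [Pi.add_apply]
    module
  map_smul' c u := by
    simp only [Pi.smul_apply, smul_eq_mul, RingHom.id_apply]
    module

lemma comb_sq (a b c d : A) (s : Md) :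
    (a • rA1 + b • rB2 + c • rB1 + d • rA2) ((a • rA1 + b • rB2 + c • rB1 + d • rA2) s)
      = ((a * b - c * d) * T) • s := by
  ext i j : 2
  fin_cases i <;> fin_cases j <;>
    simp [rA1, rA2, rB1, rB2, b1, b2, Matrix.vecHead, Matrix.vecTail] <;> ring

lemma fr_sq (v : Fin 4 → A) : fr v * fr v = algebraMap A _ (Qf v) := by
  refine LinearMap.ext fun s => ?_
  rw [Module.End.mul_apply]
  change (_ • rA1 + _ • rB2 + _ • rB1 + _ • rA2) ((_ • rA1 + _ • rB2 + _ • rB1 + _ • rA2) s) = _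
  rw [comb_sq, Module.algebraMap_end_apply]
  congr 1
  simp only [Qf, QuadraticMap.weightedSumSquares_apply, Fin.sum_univ_four, smul_eq_mul, T]
  linear_combination (-(4 * hf^2 * Polynomial.X * ((v 0)^2 + (v 2)^2))) * JJ + (hf * 2 + 1) * (Polynomial.X * ((v 0)^2+ (v 1)^2+ (v 2)^2+ (v 3)^2)) * hf2

def rho : Cl →ₐ[A] Module.End A Md := CliffordAlgebra.lift Qf ⟨fr, fr_sq⟩

def vac : Md := ![![1,0,0,0],0,0,0]

def Phi : Cl →ₗ[A] Md where
  toFun u := rho (CliffordAlgebra.reverse u) vac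
  map_add' u v := by simp
  map_smul' c u := by simp

lemma Phi_mul_ι (u : Cl) (v : Fin 4 → A) : Phi (u * CliffordAlgebra.ι Qf v) = fr v (Phi u) := by
  simp [Phi, rho]

lemma ii_smul (u : Cl) : ii * u = J • u := by
  rw [ii, IsScalarTower.algebraMap_apply ℂ A Cl, ← Algebra.smul_def]
  rfl

lemma w11_ι : w11 = CliffordAlgebra.ι Qf ![J, 1, 0, 0] := by
  rw [w11, ii_smul, η, η, ← map_smul, ← map_add]; congr 1
  ext i : 1; fin_cases i <;> simp [Pi.single_apply]
lemma w22_ι : w22 = CliffordAlgebra.ι Qf ![-J, 1, 0, 0] := by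
  rw [w22, ii_smul, η, η, ← map_smul, ← map_sub]; congr 1
  ext i : 1; fin_cases i <;> simp [Pi.single_apply]
lemma w12_ι : w12 = CliffordAlgebra.ι Qf ![0, 0, J, -1] := by
  rw [w12, ii_smul, η, η, ← map_smul, ← map_neg, ← map_add]; congr 1
  ext i : 1; fin_cases i <;> simp [Pi.single_apply]
lemma w21_ι : w21 = CliffordAlgebra.ι Qf ![0, 0, J, 1] := by
  rw [w21, ii_smul, η, η, ← map_smul, ← map_add]; congr 1
  ext i : 1; fin_cases i <;> simp [Pi.single_apply]

lemma Phi_w11 (u : Cl) : Phi (u * w11) = rA1 (Phi u) := by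
  rw [w11_ι, Phi_mul_ι]
  have h1 : hf * (1 - J * J) = 1 := by linear_combination hf2 - hf * JJ
  have h2 : hf * (1 + J * J) = 0 := by linear_combination hf * JJ
  simp [fr, h1, h2]
lemma Phi_w22 (u : Cl) : Phi (u * w22) = rB2 (Phi u) := by
  rw [w22_ι, Phi_mul_ι]
  have h1 : hf * (1 + J * J) = 0 := by linear_combination hf * JJ
  have h2 : hf * (1 + -(J * J)) = 1 := by linear_combination hf2 - hf * JJ
  simp [fr, h1, h2]
lemma Phi_w12 (u : Cl) : Phi (u * w12) = rB1 (Phi u) := by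
  rw [w12_ι, Phi_mul_ι]
  have h1 : hf * (1 - J * J) = 1 := by linear_combination hf2 - hf * JJ
  have h2 : hf * (-1 - J * J) = 0 := by linear_combination - hf * JJ
  simp [fr, h1, h2]
lemma Phi_w21 (u : Cl) : Phi (u * w21) = rA2 (Phi u) := by
  rw [w21_ι, Phi_mul_ι]
  have h1 : hf * (1 - J * J) = 1 := by linear_combination hf2 - hf * JJ
  have h2 : hf * (-1 - J * J) = 0 := by linear_combination - hf * JJ
  simp [fr, h1, h2]

-- relations
lemma ι_anti (v w : Fin 4 → A) : CliffordAlgebra.ι Qf v * CliffordAlgebra.ι Qf w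
    = algebraMap A Cl (2 * Polynomial.X * (v 0 * w 0 + v 1 * w 1 + v 2 * w 2 + v 3 * w 3))
      - CliffordAlgebra.ι Qf w * CliffordAlgebra.ι Qf v := by
  rw [eq_sub_iff_add_eq, CliffordAlgebra.ι_mul_ι_add_swap]
  congr 1
  simp only [QuadraticMap.polar, Qf, QuadraticMap.weightedSumSquares_apply, Fin.sum_univ_four, smul_eq_mul, Pi.add_apply]
  ring

lemma ι_self (v : Fin 4 → A) : CliffordAlgebra.ι Qf v * CliffordAlgebra.ι Qf v
    = algebraMap A Cl (Polynomial.X * (v 0 * v 0 + v 1 * v 1 + v 2 * v 2 + v 3 * v 3)) := by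
  rw [CliffordAlgebra.ι_sq_scalar]
  congr 1
  simp only [Qf, QuadraticMap.weightedSumSquares_apply, Fin.sum_univ_four, smul_eq_mul]
  ring

lemma s11 : w11 * w11 = 0 := by rw [w11_ι, ι_self]; simp [JJ]
lemma s22 : w22 * w22 = 0 := by rw [w22_ι, ι_self]; simp [JJ]
lemma s12 : w12 * w12 = 0 := by rw [w12_ι, ι_self]; simp [JJ]
lemma s21 : w21 * w21 = 0 := by rw [w21_ι, ι_self]; simp [JJ]
lemma a2a1 : w21 * w11 = -(w11 * w21) := by rw [w11_ι, w21_ι, ι_anti]; simp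
lemma b2b1 : w22 * w12 = -(w12 * w22) := by rw [w22_ι, w12_ι, ι_anti]; simp
lemma a1b1 : w11 * w12 = -(w12 * w11) := by rw [w11_ι, w12_ι, ι_anti]; simp
lemma a2b2 : w21 * w22 = -(w22 * w21) := by rw [w21_ι, w22_ι, ι_anti]; simp
lemma a1b2 : w11 * w22 = algebraMap A Cl T - (w22 * w11) := by
  rw [w11_ι, w22_ι, ι_anti]; congr 2; simp [JJ, T]; ring
lemma a2b1 : w21 * w12 = -algebraMap A Cl T - (w12 * w21) := by
  rw [w21_ι, w12_ι, ι_anti, ← map_neg]; congr 2; simp [JJ, T]; ring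

def psB (u : B) : Cl := algebraMap A Cl (u 0) + u 1 • w12 + u 2 • w22 + u 3 • (w12 * w22)
def psi (s : Md) : Cl := psB (s 0) + psB (s 1) * w11 + psB (s 2) * w21 + psB (s 3) * (w11 * w21)

lemma psB_add (u v : B) : psB (u + v) = psB u + psB v := by
  simp [psB, add_smul]; abel
lemma psB_neg (u : B) : psB (-u) = - psB u := by
  simp [psB]; abel
lemma psB_smul (c : A) (u : B) : psB (c • u) = algebraMap A Cl c * psB u := by
  simp [psB, mul_add, mul_assoc, Algebra.smul_def]
lemma psB_b1 (u : B) : psB (b1 u) = psB u * w12 := by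
  simp [psB, b1, add_mul, mul_assoc, b2b1, s12, Algebra.smul_def]
  simp [← mul_assoc, s12]
lemma psB_b2 (u : B) : psB (b2 u) = psB u * w22 := by
  simp [psB, b2, add_mul, mul_assoc, s22, Algebra.smul_def]
lemma psB_zero : psB 0 = 0 := by simp [psB]
lemma psB_sub (u v : B) : psB (u - v) = psB u - psB v := by
  rw [sub_eq_add_neg, psB_add, psB_neg, sub_eq_add_neg]

lemma psi_add (s t : Md) : psi (s + t) = psi s + psi t := by
  simp only [psi, Pi.add_apply, psB_add, add_mul]; abel

lemma psi_w11 (s : Md) : psi (rA1 s) = psi s * w11 := by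
  simp [psi, rA1, psB_zero, psB_neg, add_mul, mul_assoc, s11, a2a1]
  simp [← mul_assoc, s11]
lemma psi_w21 (s : Md) : psi (rA2 s) = psi s * w21 := by
  simp [psi, rA2, psB_zero, add_mul, mul_assoc, s21]
lemma Tcomm (u : Cl) : u * algebraMap A Cl T = algebraMap A Cl T * u := (Algebra.commutes _ _).symm
lemma psi_w12 (s : Md) : psi (rB1 s) = psi s * w12 := by
  have h3 : w11 * w21 * w12 = - (algebraMap A Cl T * w11) + w12 * (w11 * w21) := by
    rw [mul_assoc, a2b1, mul_sub, ← mul_assoc w11 w12, a1b1, mul_neg, Tcomm]; noncomm_ring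
  have h4 : psi s * w12 = psB (s 0) * w12 + psB (s 1) * (w11 * w12) + psB (s 2) * (w21 * w12)
      + psB (s 3) * (w11 * w21 * w12) := by simp only [psi, add_mul, mul_assoc]
  rw [h4, h3, a2b1, a1b1]
  simp only [psi, rB1, psB_sub, psB_neg, psB_smul, psB_add,
    psB_b1, LinearMap.coe_mk, AddHom.coe_mk, Matrix.cons_val]
  simp only [mul_add, mul_sub, mul_neg, add_mul, sub_mul, neg_mul, Tcomm, ← mul_assoc]
  abel
lemma psi_w22 (s : Md) : psi (rB2 s) = psi s * w22 := by
  have h3 : w11 * w21 * w22 = - (algebraMap A Cl T * w21) + w22 * (w11 * w21) := by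
    rw [mul_assoc, a2b2, mul_neg, ← mul_assoc w11 w22, a1b2]; noncomm_ring
  have h4 : psi s * w22 = psB (s 0) * w22 + psB (s 1) * (w11 * w22) + psB (s 2) * (w21 * w22)
      + psB (s 3) * (w11 * w21 * w22) := by simp only [psi, add_mul, mul_assoc]
  rw [h4, h3, a2b2, a1b2]
  simp only [psi, rB2, psB_sub, psB_neg, psB_smul, psB_add,
    psB_b2, LinearMap.coe_mk, AddHom.coe_mk, Matrix.cons_val]
  simp only [mul_add, mul_sub, mul_neg, add_mul, sub_mul, neg_mul, Tcomm, ← mul_assoc]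
  abel
lemma psi_smul (c : A) (s : Md) : psi (c • s) = c • psi s := by
  simp only [psi, Pi.smul_apply, psB_smul, Algebra.smul_def c (_ : Cl), mul_add, mul_assoc]
lemma ι_decomp (v : Fin 4 → A) : CliffordAlgebra.ι Qf v = (hf * (v 1 - J * v 0)) • w11
    + (hf * (v 1 + J * v 0)) • w22
    + (hf * (- v 3 - J * v 2)) • w12 + (hf * (v 3 - J * v 2)) • w21 := by
  rw [w11_ι, w12_ι, w21_ι, w22_ι]
  simp only [← map_smul, ← map_add]
  congr 1
  ext i : 1
  fin_cases i <;> simp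
  · linear_combination (-(v 0)) * hf2 + 2 * hf * v 0 * JJ
  · linear_combination (-(v 1)) * hf2
  · linear_combination (-(v 2)) * hf2 + 2 * hf * v 2 * JJ
  · linear_combination (-(v 3)) * hf2
lemma psi_fr (v : Fin 4 → A) (s : Md) : psi (fr v s) = psi s * CliffordAlgebra.ι Qf v := by
  rw [ι_decomp]
  simp only [fr, LinearMap.coe_mk, AddHom.coe_mk, LinearMap.add_apply, LinearMap.smul_apply,
    psi_add, psi_smul, psi_w11, psi_w12, psi_w21, psi_w22, mul_add, mul_smul_comm]
lemma psi_Phi (u : Cl) : psi (Phi u) = u := by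
  induction u using CliffordAlgebra.right_induction with
  | algebraMap r =>
    have : Phi (algebraMap A Cl r) = r • vac := by simp [Phi]
    rw [this, psi_smul, Algebra.algebraMap_eq_smul_one]
    simp [psi, vac, psB]
  | add x y hx hy => rw [map_add, psi_add, hx, hy]
  | mul_ι m x hx => rw [Phi_mul_ι, psi_fr, hx]
lemma Phi_psi (s : Md) : Phi (psi s) = s := by
  have e : ∀ c : A, Phi (algebraMap A Cl c) = c • vac := by
    intro c; simp [Phi]
  have eB : ∀ u : B, Phi (psB u) = ![u, 0, 0, 0] := by
    intro u
    have h1 : w12 = algebraMap A Cl 1 * w12 := by simp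
    have h2 : w22 = algebraMap A Cl 1 * w22 := by simp
    rw [psB, map_add, map_add, map_add, map_smul, map_smul, map_smul, Phi_w22, h1, Phi_w12, h2, Phi_w22, e, e]
    ext i j : 2
    fin_cases i <;> fin_cases j <;> simp [rB1, rB2, b1, b2, vac]
  rw [psi, map_add, map_add, map_add, ← mul_assoc, Phi_w21, Phi_w11, Phi_w21, Phi_w11, eB, eB, eB, eB]
  ext i j : 2
  fin_cases i <;> fin_cases j <;> simp [rA1, rA2]

end QA
namespace QA

/-- exactness of the first operator -/
lemma E1 (m : ℕ) (F : ℕ → Md) (h : ∀ i, i < m + 1 → rA1 (F (i + 1)) + rA2 (F i) = 0) :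
    ∃ G : ℕ → Md, ∀ i, i ≤ m + 1 → F i = rA1 (G (i + 1)) + rA2 (G i) := by
  have h1 : ∀ i, i < m + 1 → F (i + 1) 0 = 0 := fun i hi => by
    simpa [rA1, rA2] using congrFun (h i hi) 1
  have h2 : ∀ i, i < m + 1 → F i 0 = 0 := fun i hi => by
    simpa [rA1, rA2] using congrFun (h i hi) 2
  have h3 : ∀ i, i < m + 1 → -F (i + 1) 2 + F i 1 = 0 := fun i hi => by
    simpa [rA1, rA2] using congrFun (h i hi) 3
  refine ⟨fun i => ![(match i with | 0 => F 0 2 | k + 1 => F k 1), F i 3, 0, 0], fun i hi => ?_⟩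
  have h0 : F i 0 = 0 := by
    cases i with
    | zero => exact h2 0 (by omega)
    | succ k => exact h1 k (by omega)
  ext j : 1
  fin_cases j
  · simp [rA1, rA2, h0]
  · simp [rA1, rA2]
  · cases i with
    | zero => simp [rA1, rA2]
    | succ k =>
      have := h3 k (by omega)
      simp [rA1, rA2]
      linear_combination (exp := 1) -this
  · simp [rA1, rA2]

lemma T_inj {a : A} (h : T * a = 0) : a = 0 := by
  have hT : T ≠ 0 := by simp [T]
  exact (mul_eq_zero.mp h).resolve_left hT

lemma E2 (m : ℕ) (F H : ℕ → Md)
    (h : ∀ i, i < m + 1 → rA1 (H (i + 1)) + rA2 (H i) + (rB1 (F (i + 1)) + rB2 (F i)) = 0) :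
    ∃ G K : ℕ → Md, ∀ i, i ≤ m + 1 →
      F i = rA1 (G (i + 1)) + rA2 (G i) + (rB1 (K (i + 1)) + rB2 (K i)) := by
  have c (i : ℕ) (hi : i < m + 1) (k : Fin 4) := congrFun (congrFun (h i hi) 0) k
  have D0 : ∀ i, i < m + 1 → F i 1 0 = F (i + 1) 2 0 := fun i hi => by
    have := c i hi 0
    simp [rA1, rA2, rB1, rB2, b1, b2, Matrix.vecHead, Matrix.vecTail] at this
    exact sub_eq_zero.mp (T_inj (by linear_combination this))
  have D1 : ∀ i, i < m + 1 → F (i + 1) 0 0 = - (T * (F i 1 1 - F (i + 1) 2 1)) := fun i hi => by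
    have := c i hi 1
    simp [rA1, rA2, rB1, rB2, b1, b2, Matrix.vecHead, Matrix.vecTail] at this
    linear_combination this
  have D2 : ∀ i, i < m + 1 → F i 0 0 = - (T * (F i 1 2 - F (i + 1) 2 2)) := fun i hi => by
    have := c i hi 2
    simp [rA1, rA2, rB1, rB2, b1, b2, Matrix.vecHead, Matrix.vecTail] at this
    linear_combination this
  have D3 : ∀ i, i < m + 1 → F i 0 1 - F (i + 1) 0 2 = - (T * (F i 1 3 - F (i + 1) 2 3)) :=
    fun i hi => by
    have := c i hi 3
    simp [rA1, rA2, rB1, rB2, b1, b2, Matrix.vecHead, Matrix.vecTail] at this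
    linear_combination this
  obtain ⟨e0, he1, he2, he0⟩ : ∃ e0 : ℕ → A,
      (∀ i, i < m + 1 → F i 1 1 - F (i + 1) 2 1 = - e0 (i + 1)) ∧
      (∀ i, i < m + 1 → F i 1 2 - F (i + 1) 2 2 = - e0 i) ∧
      (∀ i, i ≤ m + 1 → F i 0 0 = T * e0 i) := by
    have key : ∃ e0 : ℕ → A, ∀ i, i ≤ m + 1 → F i 0 0 = T * e0 i := by
      have : ∀ i, ∃ e : A, i ≤ m + 1 → F i 0 0 = T * e := by
        intro i
        by_cases hi : i ≤ m + 1
        · cases i with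
          | zero => exact ⟨_, fun _ => by rw [D2 0 (by omega), ← mul_neg]⟩
          | succ k => exact ⟨_, fun _ => by rw [D1 k (by omega), ← mul_neg]⟩
        · exact ⟨0, fun h => absurd h hi⟩
      choose e he using this
      exact ⟨e, he⟩
    obtain ⟨e0, he0⟩ := key
    refine ⟨e0, fun i hi => ?_, fun i hi => ?_, he0⟩
    · have h1 := D1 i hi
      rw [he0 _ (by omega)] at h1
      have := T_inj (a := e0 (i + 1) + (F i 1 1 - F (i + 1) 2 1)) (by linear_combination h1)
      linear_combination this
    · have h1 := D2 i hi
      rw [he0 _ (by omega)] at h1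
      have := T_inj (a := e0 i + (F i 1 2 - F (i + 1) 2 2)) (by linear_combination h1)
      linear_combination this
  let e2 : ℕ → A := fun i => match i with | 0 => 0 | k + 1 => F k 1 3 - F (k + 1) 2 3
  let k0 : ℕ → A := fun i => match i with | 0 => F 0 0 2 | k + 1 => F k 0 1
  let K1 : ℕ → B := fun i => ![e0 i, 0, e2 i, 0]
  let G0 : ℕ → B := fun i => if i ≤ m + 1 then F i 2 else
    F (m + 1) 1 + b1 (K1 (m + 2)) + b2 (K1 (m + 1))
  refine ⟨fun i => ![G0 i, F i 3, 0, 0], fun i => ![![k0 i, F i 0 3, 0, 0], K1 i, 0, 0],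
    fun i hi => ?_⟩
  have hk2 : F i 0 2 = k0 i + T * e2 i := by
    cases i with
    | zero => simp [k0, e2]
    | succ k =>
      simp only [k0, e2]
      linear_combination - (D3 k (by omega))
  have hG : F i 1 = G0 (i + 1) - b1 (K1 (i + 1)) - b2 (K1 i) := by
    by_cases hi' : i < m + 1
    · have : G0 (i + 1) = F (i + 1) 2 := by simp only [G0]; rw [if_pos (by omega)]
      rw [this]
      ext j : 1
      fin_cases j
      · simpa [b1, b2, Matrix.vecHead, Matrix.vecTail] using D0 i hi'
      · simp [b1, b2, Matrix.vecHead, Matrix.vecTail, K1]; linear_combination he1 i hi'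
      · simp [b1, b2, Matrix.vecHead, Matrix.vecTail, K1]; linear_combination he2 i hi'
      · simp [b1, b2, Matrix.vecHead, Matrix.vecTail, K1, e2]
    · obtain rfl : i = m + 1 := by omega
      simp only [G0]; rw [if_neg (by omega)]; abel
  have hG2 : G0 i = F i 2 := by simp only [G0]; rw [if_pos hi]
  ext j : 1
  fin_cases j
  · ext l : 1
    fin_cases l
    · simpa [rA1, rA2, rB1, rB2, b1, b2, K1] using he0 i hi
    · simp [rA1, rA2, rB1, rB2, b1, b2, K1, k0]
    · simpa [rA1, rA2, rB1, rB2, b1, b2, K1] using hk2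
    · simp [rA1, rA2, rB1, rB2, b1, b2, K1]
  · simp [rA1, rA2, rB1, rB2, hG]; abel
  · simp [rA1, rA2, rB1, rB2, hG2]
  · simp [rA1, rA2, rB1, rB2]

/-- model relations used in the zigzag -/
lemma sqB1 (s : Md) : rB1 (rB1 s) = 0 := by
  simpa using comb_sq 0 0 1 0 s
lemma sqB2 (s : Md) : rB2 (rB2 s) = 0 := by
  simpa using comb_sq 0 1 0 0 s
lemma acB (s : Md) : rB1 (rB2 s) = - rB2 (rB1 s) := by
  have := comb_sq 0 1 1 0 s
  simp [sqB1, sqB2] at this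
  exact eq_neg_of_add_eq_zero_left (by rw [← this] <;> abel)
lemma sqA1 (s : Md) : rA1 (rA1 s) = 0 := by
  simpa using comb_sq 1 0 0 0 s
lemma sqA2 (s : Md) : rA2 (rA2 s) = 0 := by
  simpa using comb_sq 0 0 0 1 s
lemma acA (s : Md) : rA2 (rA1 s) = - rA1 (rA2 s) := by
  have := comb_sq 1 0 0 1 s
  simp [sqA1, sqA2] at this
  exact eq_neg_of_add_eq_zero_left (by rw [← this] <;> abel)
lemma ac11 (s : Md) : rA1 (rB1 s) = - rB1 (rA1 s) := by
  have := comb_sq 1 0 1 0 s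
  simp [sqA1, sqB1] at this
  exact eq_neg_of_add_eq_zero_left (by rw [← this] <;> abel)
lemma ac22 (s : Md) : rA2 (rB2 s) = - rB2 (rA2 s) := by
  have := comb_sq 0 1 0 1 s
  simp [sqA2, sqB2] at this
  exact eq_neg_of_add_eq_zero_left (by rw [← this] <;> abel)
lemma ac12 (s : Md) : rA1 (rB2 s) = T • s - rB2 (rA1 s) := by
  have := comb_sq 1 1 0 0 s
  simp [sqA1, sqB2] at this
  rw [← this]; abel
lemma ac21 (s : Md) : rA2 (rB1 s) = - (T • s) - rB1 (rA2 s) := by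
  have := comb_sq 0 0 1 1 s
  simp [sqA2, sqB1] at this
  rw [← this]; abel

lemma zig (m n : ℕ) (F : ℕ → ℕ → Md)
    (h : ∀ i j, i < m + 1 → j < n + 1 →
      rA1 (F (i+1) (j+1)) + rA2 (F i (j+1)) + (rB1 (F (i + 1) j) + rB2 (F i j)) = 0) :
    ∃ G : ℕ → ℕ → Md, ∀ i j, i ≤ m + 1 → j ≤ n + 1 →
      F i j = rA1 (G (i+1) (j+1)) + rA2 (G i (j+1)) + (rB1 (G (i + 1) j) + rB2 (G i j)) := by
  suffices H : ∀ k, k ≤ n + 1 → ∃ G : ℕ → ℕ → Md, ∀ i j, i ≤ m + 1 → j ≤ k →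
      F i j = rA1 (G (i+1) (j+1)) + rA2 (G i (j+1)) + (rB1 (G (i + 1) j) + rB2 (G i j)) from
    H (n + 1) le_rfl
  intro k
  induction k with
  | zero =>
    intro _
    obtain ⟨G, K, hGK⟩ := E2 m (fun i => F i 0) (fun i => F i 1) (fun i hi => h i 0 hi (by omega))
    refine ⟨fun i j => if j = 0 then K i else G i, fun i j hi hj => ?_⟩
    obtain rfl : j = 0 := by omega
    simpa using hGK i hi
  | succ k ih =>
    intro hk
    obtain ⟨G, hG⟩ := ih (by omega)
    obtain ⟨N, hN⟩ := E1 m (fun i => F i (k+1) - (rB1 (G (i + 1) (k+1)) + rB2 (G i (k+1)))) (by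
      intro i hi
      have h0 := h i k hi (by omega)
      rw [hG i k (by omega) le_rfl, hG (i+1) k (by omega) le_rfl] at h0
      simp only [map_add, map_sub, ac11, ac22, ac12, ac21, sqB1, sqB2, acB] at h0 ⊢
      rw [← h0]; abel)
    refine ⟨fun i j => if j ≤ k + 1 then G i j else N i, fun i j hi hj => ?_⟩
    beta_reduce
    rcases Nat.lt_or_ge j (k + 1) with hj' | hj'
    · simp only [show j ≤ k + 1 by omega, show j + 1 ≤ k + 1 by omega, if_true]
      exact hG i j hi (by omega)
    · obtain rfl : j = k + 1 := by omega
      simp only [le_refl, show ¬ (k + 1 + 1 ≤ k + 1) by omega, if_true, if_false]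
      exact sub_eq_iff_eq_add.mp (hN i hi)

/-- the difference operator -/
def nab (F : ℕ → ℕ → Cl) (i j : ℕ) : Cl :=
  F (i+1) (j+1) * w11 + F i (j+1) * w21 + F (i+1) j * w12 + F i j * w22

lemma nab_nab (F : ℕ → ℕ → Cl) (i j : ℕ) : nab (nab F) i j = 0 := by
  simp only [nab, add_mul, mul_assoc, s11, s12, s21, s22, a2a1, b2b1, a1b1, a2b2, a1b2, a2b1,
    mul_sub, mul_neg, mul_zero]
  abel

lemma exact_nab (m n : ℕ) (F : ℕ → ℕ → Cl) (h : ∀ i j, i ≤ m → j ≤ n → nab F i j = 0) :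
    ∃ G : ℕ → ℕ → Cl, ∀ i j, i ≤ m + 1 → j ≤ n + 1 → F i j = nab G i j := by
  obtain ⟨G, hG⟩ := zig m n (fun i j => Phi (F i j)) (fun i j hi hj => by
    have := congrArg Phi (h i j (by omega) (by omega))
    rw [nab, map_add, map_add, map_add, Phi_w11, Phi_w12, Phi_w21, Phi_w22, map_zero] at this
    rw [← this] <;> abel)
  refine ⟨fun i j => psi (G i j), fun i j hi hj => ?_⟩
  have := congrArg psi (hG i j hi hj)
  rw [psi_Phi, psi_add, psi_add, psi_add, psi_w11, psi_w12, psi_w21, psi_w22] at this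
  rw [this, nab]; abel

end QA
namespace QA

def ex (a b c d : ℕ) : Fin 4 →₀ ℕ := Finsupp.equivFunOnFinite.symm ![a, b, c, d]

def dp (a b c d : ℕ) : P4 :=
  MvPolynomial.monomial (ex a b c d)
    ((a.factorial * b.factorial * c.factorial * d.factorial : ℂ))⁻¹

lemma fne (a : ℕ) : (a.factorial : ℂ) ≠ 0 := by exact_mod_cast a.factorial_ne_zero

lemma pd0 (a b c d : ℕ) : pd 0 (dp (a+1) b c d) = dp a b c d := by
  have he : ex (a+1) b c d - Finsupp.single 0 1 = ex a b c d := by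
    ext i; fin_cases i <;> simp [ex]
  rw [pd, dp, dp]
  change MvPolynomial.pderiv _ (MvPolynomial.monomial _ _) = _
  rw [MvPolynomial.pderiv_monomial, he]
  congr 1
  have := fne a; have := fne b; have := fne c; have := fne d
  have : (a + 1 : ℂ) ≠ 0 := by exact_mod_cast Nat.succ_ne_zero a
  simp [ex, Nat.factorial_succ]; field_simp
lemma pd1 (a b c d : ℕ) : pd 1 (dp a (b+1) c d) = dp a b c d := by
  have he : ex a (b+1) c d - Finsupp.single 1 1 = ex a b c d := by
    ext i; fin_cases i <;> simp [ex]
  rw [pd, dp, dp]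
  change MvPolynomial.pderiv _ (MvPolynomial.monomial _ _) = _
  rw [MvPolynomial.pderiv_monomial, he]
  congr 1
  have := fne a; have := fne b; have := fne c; have := fne d
  have : (b + 1 : ℂ) ≠ 0 := by exact_mod_cast Nat.succ_ne_zero b
  simp [ex, Nat.factorial_succ]; field_simp
lemma pd2 (a b c d : ℕ) : pd 2 (dp a b (c+1) d) = dp a b c d := by
  have he : ex a b (c+1) d - Finsupp.single 2 1 = ex a b c d := by
    ext i; fin_cases i <;> simp [ex]
  rw [pd, dp, dp]
  change MvPolynomial.pderiv _ (MvPolynomial.monomial _ _) = _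
  rw [MvPolynomial.pderiv_monomial, he]
  congr 1
  have := fne a; have := fne b; have := fne c; have := fne d
  have : (c + 1 : ℂ) ≠ 0 := by exact_mod_cast Nat.succ_ne_zero c
  simp [ex, Nat.factorial_succ]; field_simp
lemma pd3 (a b c d : ℕ) : pd 3 (dp a b c (d+1)) = dp a b c d := by
  have he : ex a b c (d+1) - Finsupp.single 3 1 = ex a b c d := by
    ext i; fin_cases i <;> simp [ex]
  rw [pd, dp, dp]
  change MvPolynomial.pderiv _ (MvPolynomial.monomial _ _) = _
  rw [MvPolynomial.pderiv_monomial, he]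
  congr 1
  have := fne a; have := fne b; have := fne c; have := fne d
  have : (d + 1 : ℂ) ≠ 0 := by exact_mod_cast Nat.succ_ne_zero d
  simp [ex, Nat.factorial_succ]; field_simp
lemma pd0' (b c d : ℕ) : pd 0 (dp 0 b c d) = 0 := by
  simp [pd, dp, MvPolynomial.pderiv_monomial, ex]
lemma pd1' (a c d : ℕ) : pd 1 (dp a 0 c d) = 0 := by
  simp [pd, dp, MvPolynomial.pderiv_monomial, ex]
lemma pd2' (a b d : ℕ) : pd 2 (dp a b 0 d) = 0 := by
  simp [pd, dp, MvPolynomial.pderiv_monomial, ex]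
lemma pd3' (a b c : ℕ) : pd 3 (dp a b c 0) = 0 := by
  simp [pd, dp, MvPolynomial.pderiv_monomial, ex]

/-- divided power basis element of bidegree (m,n) -/
def e (m n i j : ℕ) : P4 := dp i (m - i) j (n - j)

def recon (m n : ℕ) (F : ℕ → ℕ → Cl) : MCl :=
  ∑ i ∈ Finset.range (m + 1), ∑ j ∈ Finset.range (n + 1), F i j ⊗ₜ[ℂ] e m n i j

lemma recon_congr (m n : ℕ) (F G : ℕ → ℕ → Cl) (h : ∀ i j, i ≤ m → j ≤ n → F i j = G i j) :
    recon m n F = recon m n G := by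
  refine Finset.sum_congr rfl fun i hi => Finset.sum_congr rfl fun j hj => ?_
  rw [h i j (by simp at hi; omega) (by simp at hj; omega)]

lemma sumA (m : ℕ) {M : Type*} [AddCommMonoid M] (f g : ℕ → M) (h0 : f 0 = 0)
    (h : ∀ i, i ≤ m → f (i + 1) = g i) :
    ∑ i ∈ Finset.range (m + 1 + 1), f i = ∑ i ∈ Finset.range (m + 1), g i := by
  rw [Finset.sum_range_succ', h0, add_zero]
  exact Finset.sum_congr rfl fun i hi => h i (by simp at hi; omega)
lemma sumB (m : ℕ) {M : Type*} [AddCommMonoid M] (f g : ℕ → M) (h0 : f (m + 1) = 0)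
    (h : ∀ i, i ≤ m → f i = g i) :
    ∑ i ∈ Finset.range (m + 1 + 1), f i = ∑ i ∈ Finset.range (m + 1), g i := by
  rw [Finset.sum_range_succ, h0, add_zero]
  exact Finset.sum_congr rfl fun i hi => h i (by simp at hi; omega)

lemma add4 {M : Type*} [Add M] {a b c d a' b' c' d' : M} (h1 : a = a') (h2 : b = b')
    (h3 : c = c') (h4 : d = d') : a + b + c + d = a' + b' + c' + d' := by
  rw [h1, h2, h3, h4]

lemma nabla_recon (m n : ℕ) (F : ℕ → ℕ → Cl) :
    nabla (recon (m + 1) (n + 1) F) = recon m n (nab F) := by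
  have hR : recon m n (nab F) =
      (∑ i ∈ Finset.range (m + 1), ∑ j ∈ Finset.range (n + 1), (F (i+1) (j+1) * w11) ⊗ₜ[ℂ] e m n i j)
    + (∑ i ∈ Finset.range (m + 1), ∑ j ∈ Finset.range (n + 1), (F i (j+1) * w21) ⊗ₜ[ℂ] e m n i j)
    + (∑ i ∈ Finset.range (m + 1), ∑ j ∈ Finset.range (n + 1), (F (i+1) j * w12) ⊗ₜ[ℂ] e m n i j)
    + (∑ i ∈ Finset.range (m + 1), ∑ j ∈ Finset.range (n + 1), (F i j * w22) ⊗ₜ[ℂ] e m n i j) := by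
    simp only [recon, nab, TensorProduct.add_tmul, Finset.sum_add_distrib]
  rw [hR]
  simp only [nabla, LinearMap.add_apply, recon, map_sum, TensorProduct.map_tmul,
    LinearMap.mulRight_apply, LinearMap.comp_apply]
  simp only [Finset.sum_add_distrib]
  apply add4
  · apply sumA m
    · refine Finset.sum_eq_zero fun j hj => ?_
      cases j with
      | zero => simp [e, pd2']
      | succ j => simp [e, pd2, pd0']
    intro i hi
    apply sumA n
    · simp [e, pd2']
    intro j hj
    simp [e, pd2, pd0]
  · apply sumB m
    · refine Finset.sum_eq_zero fun j hj => ?_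
      cases j with
      | zero => simp [e, pd2']
      | succ j => simp [e, pd2, pd1']
    intro i hi
    apply sumA n
    · simp [e, pd2']
    intro j hj
    simp [e, pd2, pd1, Nat.succ_sub hi]
  · apply sumA m
    · refine Finset.sum_eq_zero fun j hj => ?_
      rcases Nat.lt_or_ge j (n + 1) with h | h
      · simp [e, Nat.succ_sub (Nat.lt_succ_iff.mp h), pd3, pd0']
      · obtain rfl : j = n + 1 := by simp at hj; omega
        simp [e, pd3']
    intro i hi
    apply sumB n
    · simp [e, pd3']
    intro j hj
    simp [e, pd3, pd0, Nat.succ_sub hj]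
  · apply sumB m
    · refine Finset.sum_eq_zero fun j hj => ?_
      rcases Nat.lt_or_ge j (n + 1) with h | h
      · simp [e, Nat.succ_sub (Nat.lt_succ_iff.mp h), pd3, pd1']
      · obtain rfl : j = n + 1 := by simp at hj; omega
        simp [e, pd3']
    intro i hi
    apply sumB n
    · simp [e, pd3']
    intro j hj
    simp [e, pd3, pd1, Nat.succ_sub hj, Nat.succ_sub hi]

lemma weight_wx (d : Fin 4 →₀ ℕ) : Finsupp.weight wx d = d 0 + d 1 := by
  rw [Finsupp.weight_apply, Finsupp.sum_fintype _ _ (by simp)]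
  simp [Fin.sum_univ_four, wx]
lemma weight_wy (d : Fin 4 →₀ ℕ) : Finsupp.weight wy d = d 2 + d 3 := by
  rw [Finsupp.weight_apply, Finsupp.sum_fintype _ _ (by simp)]
  simp [Fin.sum_univ_four, wy]

lemma recon_mem (m n : ℕ) (F : ℕ → ℕ → Cl) : recon m n F ∈ MA m n := by
  refine Submodule.sum_mem _ fun i hi => Submodule.sum_mem _ fun j hj => Submodule.subset_span ?_
  simp only [Finset.mem_range] at hi hj
  refine ⟨_, _, ?_, ?_, rfl⟩
  · apply MvPolynomial.isWeightedHomogeneous_monomial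
    rw [weight_wx]; simp [ex]; omega
  · apply MvPolynomial.isWeightedHomogeneous_monomial
    rw [weight_wy]; simp [ex]; omega

def cf (d : Fin 4 →₀ ℕ) : MCl →ₗ[ℂ] Cl :=
  (TensorProduct.rid ℂ Cl).toLinearMap ∘ₗ (LinearMap.lTensor Cl (MvPolynomial.lcoeff ℂ d))

lemma cf_tmul (d : Fin 4 →₀ ℕ) (u : Cl) (p : P4) : cf d (u ⊗ₜ p) = MvPolynomial.coeff d p • u := by
  simp [cf, MvPolynomial.lcoeff]

lemma recon_inj (m n : ℕ) (F : ℕ → ℕ → Cl) (h : recon m n F = 0) (i j : ℕ) (hi : i ≤ m) (hj : j ≤ n) :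
    F i j = 0 := by
  have h1 := congrArg (cf (ex i (m - i) j (n - j))) h
  simp only [recon, map_sum, map_zero, cf_tmul] at h1
  rw [Finset.sum_eq_single i, Finset.sum_eq_single j] at h1
  · simp only [e, dp, MvPolynomial.coeff_monomial, if_true] at h1
    refine (smul_eq_zero.mp h1).resolve_left (inv_ne_zero ?_)
    simp [Nat.factorial_ne_zero]
  · intro b _ hb
    rw [e, dp, MvPolynomial.coeff_monomial, if_neg, zero_smul]
    intro h2; exact hb (by simpa [ex] using DFunLike.congr_fun h2 2)
  · intro h; simp at h; omega
  · intro b _ hb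
    refine Finset.sum_eq_zero fun c _ => ?_
    rw [e, dp, MvPolynomial.coeff_monomial, if_neg, zero_smul]
    intro h2; exact hb (by simpa [ex] using DFunLike.congr_fun h2 0)
  · intro h; simp at h; omega

lemma recon_add (m n : ℕ) (F G : ℕ → ℕ → Cl) : recon m n (F + G) = recon m n F + recon m n G := by
  simp [recon, TensorProduct.add_tmul, Finset.sum_add_distrib]
lemma recon_smul (m n : ℕ) (c : ℂ) (F : ℕ → ℕ → Cl) : recon m n (c • F) = c • recon m n F := by
  simp only [recon, Finset.smul_sum, Pi.smul_apply, TensorProduct.smul_tmul']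

def reconL (m n : ℕ) : (ℕ → ℕ → Cl) →ₗ[ℂ] MCl where
  toFun := recon m n
  map_add' := recon_add m n
  map_smul' := recon_smul m n

lemma MA_eq (m n : ℕ) : MA m n ≤ LinearMap.range (reconL m n) := by
  rw [MA, Submodule.span_le]
  rintro _ ⟨u, p, hx, hy, rfl⟩
  rw [SetLike.mem_coe, p.as_sum, TensorProduct.tmul_sum]
  refine Submodule.sum_mem _ fun d hd => ?_
  have hc := MvPolynomial.mem_support_iff.mp hd
  have h1 := hx hc
  have h2 := hy hc
  rw [weight_wx] at h1
  rw [weight_wy] at h2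
  refine ⟨fun i j => if i = d 0 ∧ j = d 2 then
    ((((d 0).factorial * (d 1).factorial * (d 2).factorial * (d 3).factorial : ℂ)) *
      MvPolynomial.coeff d p) • u else 0, ?_⟩
  change recon m n _ = _
  rw [recon, Finset.sum_eq_single (d 0), Finset.sum_eq_single (d 2)]
  · rw [if_pos ⟨rfl, rfl⟩, TensorProduct.smul_tmul]
    congr 1
    have h3 : m - d 0 = d 1 := by omega
    have h4 : n - d 2 = d 3 := by omega
    have h5 : ex (d 0) (d 1) (d 2) (d 3) = d := by
      ext i; fin_cases i <;> simp [ex]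
    rw [e, dp, h3, h4, h5, MvPolynomial.smul_monomial]
    congr 1
    have := fne (d 0); have := fne (d 1); have := fne (d 2); have := fne (d 3)
    rw [smul_eq_mul]
    field_simp
  · intro b _ hb
    rw [if_neg (by tauto), TensorProduct.zero_tmul]
  · intro h; simp at h; omega
  · intro b _ hb
    refine Finset.sum_eq_zero fun c _ => ?_
    rw [if_neg (by tauto), TensorProduct.zero_tmul]
  · intro h; simp at h; omega

end QA

/-- for `m, n ≥ 1`,
`ker(∇ : M_A^{m,n} → M_A^{m−1,n−1}) = ∇(M_A^{m+1,n+1})`: the quadrant-A complexes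
are exact at every interior point. -/
theorem quadrantA_exact (m n : ℕ) (hm : 1 ≤ m) (hn : 1 ≤ n) :
    MA m n ⊓ LinearMap.ker nabla = Submodule.map nabla (MA (m + 1) (n + 1)) := by
  obtain ⟨m, rfl⟩ : ∃ k, m = k + 1 := ⟨m - 1, by omega⟩
  obtain ⟨n, rfl⟩ : ∃ k, n = k + 1 := ⟨n - 1, by omega⟩
  apply le_antisymm
  · rintro z ⟨hz, hk⟩
    obtain ⟨F, rfl⟩ := QA.MA_eq _ _ hz
    change nabla (QA.recon _ _ F) = 0 at hk
    rw [QA.nabla_recon] at hk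
    obtain ⟨G, hG⟩ := QA.exact_nab m n F (fun i j hi hj => QA.recon_inj m n _ hk i j hi hj)
    refine ⟨QA.recon (m + 1 + 1) (n + 1 + 1) G, QA.recon_mem _ _ _, ?_⟩
    rw [QA.nabla_recon]
    exact (QA.recon_congr _ _ _ _ hG).symm
  · rintro _ ⟨z, hz, rfl⟩
    obtain ⟨G, rfl⟩ := QA.MA_eq _ _ hz
    change nabla (QA.recon _ _ G) ∈ _
    rw [QA.nabla_recon]
    refine ⟨QA.recon_mem _ _ _, ?_⟩
    change nabla (QA.recon _ _ _) = 0
    rw [QA.nabla_recon, QA.recon_congr m n _ (fun _ _ => 0) (fun i j _ _ => QA.nab_nab G i j)]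
    simp [QA.recon]

end
end
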